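/- Two holomorphic IFS (G, Ω_G) and (F, Ω_F) that satisfy the strong separation condition have the same attractor if and only if Prep_G = Prep_F. -/

import Mathlib

open Set Metric

noncomputable section

/-- A finite holomorphic IFS: a bounded domain `Ω ⊂ ℂ` together with finitely many
univalent maps `g i : Ω → Ω` with `closure (g i '' Ω) ⊆ Ω`. -/
structure HolIFS where
  /-- the number of maps -/
  m : ℕ
  hm : 1 ≤ m
  /-- the domain -/
  Ω : Set ℂ
  hopen : IsOpen Ω
  hconn : IsConnected Ω
  hbdd : Bornology.IsBounded Ω
  /-- the maps of the IFS -/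
  g : Fin m → ℂ → ℂ
  hdiff : ∀ i, DifferentiableOn ℂ (g i) Ω
  hinj : ∀ i, Set.InjOn (g i) Ω
  hcl : ∀ i, closure (g i '' Ω) ⊆ Ω

/-- `A` is the attractor of the IFS `S`: the (unique) nonempty compact subset of `Ω`
with `A = ⋃ i, g i '' A`. -/
def HolIFS.IsAttractor (S : HolIFS) (A : Set ℂ) : Prop :=
  A.Nonempty ∧ IsCompact A ∧ A ⊆ S.Ω ∧ A = ⋃ i, S.g i '' A

/-- The strong separation condition for the IFS `S` with attractor `A`. -/
def HolIFS.SSC (S : HolIFS) (A : Set ℂ) : Prop :=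
  ∀ i j : Fin S.m, i ≠ j → Disjoint (S.g i '' A) (S.g j '' A)

/-- For a finite word `w = [i₁, …, i_k]`, the composition `g_w = g i₁ ∘ ⋯ ∘ g i_k`. -/
def HolIFS.word (S : HolIFS) (w : List (Fin S.m)) : ℂ → ℂ :=
  w.foldr (fun i f => S.g i ∘ f) id

/-- The set `Per_G` of fixed points of the maps `g_w`, `w ∈ Λ*`. -/
def HolIFS.Per (S : HolIFS) : Set ℂ :=
  {β | β ∈ S.Ω ∧ ∃ w : List (Fin S.m), w ≠ [] ∧ S.word w β = β}

/-- The set `Prep_G = Per_G ∪ {g_w x : w ∈ Λ*, x ∈ Per_G}` of (pre-)periodic points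
(the empty word `w` gives `g_w = id`, so `Per_G ⊆ Prep_G`). -/
def HolIFS.Prep (S : HolIFS) : Set ℂ :=
  {y | ∃ (w : List (Fin S.m)) (x : ℂ), x ∈ S.Per ∧ y = S.word w x}


open Filter Topology in
lemma aux_deriv_ne_zero {U : Set ℂ} (hU : IsOpen U) {f : ℂ → ℂ} (hf : DifferentiableOn ℂ f U)
    (hinj : InjOn f U) {z : ℂ} (hz : z ∈ U) : deriv f z ≠ 0 := by
  intro hd
  have hfa : AnalyticAt ℂ f z := hf.analyticAt (hU.mem_nhds hz)
  have hga : AnalyticAt ℂ (fun x => f x - f z) z := hfa.sub analyticAt_const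
  have hne : analyticOrderAt (fun x => f x - f z) z ≠ ⊤ := by
    intro h
    rw [analyticOrderAt_eq_top] at h
    have h1 : ∀ᶠ x in 𝓝[≠] z, f x - f z = 0 ∧ x ∈ U ∧ x ≠ z := by
      filter_upwards [h.filter_mono nhdsWithin_le_nhds,
        (hU.mem_nhds hz : U ∈ 𝓝 z) |> mem_nhdsWithin_of_mem_nhds, self_mem_nhdsWithin]
        with x h1 h2 h3 using ⟨h1, h2, h3⟩
    obtain ⟨x, h1, h2, h3⟩ := h1.exists
    exact h3 (hinj h2 hz (sub_eq_zero.1 h1))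
  obtain ⟨k, hk, hk0, hkeq⟩ := hga.analyticOrderAt_ne_top.1 hne
  set n := analyticOrderNatAt (fun x => f x - f z) z with hn
  have hkz := hkeq.self_of_nhds
  have hn2 : 2 ≤ n := by
    have h0 : n ≠ 0 := by
      intro h0
      simp [h0] at hkz
      exact hk0 hkz.symm
    have h1 : n ≠ 1 := by
      intro h1
      rw [h1] at hkeq
      have h2 : HasDerivAt (fun x => (x - z) ^ 1 • k x) (k z) z := by
        have := ((hasDerivAt_id' z).sub_const z).fun_mul hk.differentiableAt.hasDerivAt
        simpa using this
      have h3 : HasDerivAt (fun x => f x - f z) (k z) z := h2.congr_of_eventuallyEq hkeq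
      have h4 : HasDerivAt (fun x => f x - f z) 0 z := by
        rw [← hd]; exact hfa.differentiableAt.hasDerivAt.sub_const _
      exact hk0 (h3.unique h4)
    omega
  have hn0 : (n : ℂ) ≠ 0 := by exact_mod_cast (by omega : n ≠ 0)
  obtain ⟨c, hc⟩ := IsAlgClosed.exists_pow_nat_eq (k z) (by omega : 0 < n)
  have hc0 : c ≠ 0 := by
    rintro rfl
    rw [zero_pow (by omega)] at hc
    exact hk0 hc.symm
  let r : ℂ → ℂ := fun x => c * Complex.exp (Complex.log (k x / k z) / n)
  have hra : AnalyticAt ℂ r z := by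
    refine analyticAt_const.mul (AnalyticAt.cexp ((AnalyticAt.clog (hk.div analyticAt_const hk0) ?_).div analyticAt_const hn0))
    simp [hk0]
  have hrz : r z = c := by simp [r, hk0]
  have hrn : ∀ᶠ x in 𝓝 z, r x ^ n = k x := by
    filter_upwards [hk.continuousAt.eventually_ne hk0] with x hx
    simp only [r]
    rw [mul_pow, hc, ← Complex.exp_nat_mul, mul_div_cancel₀ _ hn0, Complex.exp_log (div_ne_zero hx hk0)]
    field_simp
  let ψ : ℂ → ℂ := fun x => (x - z) * r x
  have hψa : AnalyticAt ℂ ψ z := (analyticAt_id.sub analyticAt_const).mul hra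
  have hψd : HasDerivAt ψ c z := by
    have := ((hasDerivAt_id' z).sub_const z).fun_mul hra.differentiableAt.hasDerivAt
    simpa [hrz] using this
  have hψs : HasStrictDerivAt ψ c z := by
    have := hψa.hasStrictDerivAt
    rwa [hψd.deriv] at this
  have hmap := hψs.map_nhds_eq hc0
  have hψz : ψ z = 0 := by simp [ψ]
  rw [hψz] at hmap
  have hgood : ∀ᶠ x in 𝓝 z, x ∈ U ∧ f x - f z = ψ x ^ n := by
    filter_upwards [hU.mem_nhds hz, hrn, hkeq] with x h1 h2 h3
    refine ⟨h1, ?_⟩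
    rw [h3, smul_eq_mul, ← h2]; exact (mul_pow _ _ _).symm
  have himg : ∀ᶠ t in 𝓝 (0:ℂ), ∃ x, (x ∈ U ∧ f x - f z = ψ x ^ n) ∧ ψ x = t := by
    rw [← hmap]
    exact eventually_map.2 (hgood.mono fun x hx => ⟨x, hx, rfl⟩)
  have hζ := Complex.isPrimitiveRoot_exp n (by omega)
  set ζ := Complex.exp (2 * Real.pi * Complex.I / n) with hζdef
  have himg2 : ∀ᶠ t in 𝓝 (0:ℂ), ∃ x, (x ∈ U ∧ f x - f z = ψ x ^ n) ∧ ψ x = ζ * t := by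
    have : Tendsto (fun t : ℂ => ζ * t) (𝓝 0) (𝓝 0) := by
      have : Continuous (fun t : ℂ => ζ * t) := by fun_prop
      simpa using this.tendsto 0
    exact this.eventually himg
  have h3 : ∀ᶠ t in 𝓝[≠] (0:ℂ), t ≠ 0 := self_mem_nhdsWithin
  obtain ⟨t, ⟨⟨x, ⟨hx1, hx2⟩, hx3⟩, ⟨y, ⟨hy1, hy2⟩, hy3⟩⟩, ht⟩ :=
    (((himg.and himg2).filter_mono nhdsWithin_le_nhds).and h3).exists
  have hxy : f x = f y := by
    have : f x - f z = f y - f z := by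
      rw [hx2, hy2, hx3, hy3, mul_pow, hζ.pow_eq_one, one_mul]
    exact sub_left_inj.1 this
  have := hinj hx1 hy1 hxy
  subst this
  rw [hx3] at hy3
  have : ζ = 1 := by
    have h5 : (ζ - 1) * t = 0 := by linear_combination -hy3
    rcases mul_eq_zero.1 h5 with h | h
    · exact sub_eq_zero.1 h
    · exact absurd h ht
  exact hζ.ne_one (by omega) this

lemma aux_quad {U A : Set ℂ} (hU : IsOpen U) {f : ℂ → ℂ} (hf : DifferentiableOn ℂ f U)
    (hA : IsCompact A) (hAU : A ⊆ U) : ∃ L : ℝ, 0 < L ∧ ∀ x ∈ A, ∀ b ∈ A,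
      ‖f x - f b - deriv f b * (x - b)‖ ≤ L * ‖x - b‖ ^ 2 := by
  obtain ⟨δ, hδ, hsub⟩ := hA.exists_cthickening_subset_open hU hAU
  have hK : IsCompact (cthickening δ A) := hA.cthickening
  have hf1 := hf.deriv hU
  have hf2 := hf1.deriv hU
  obtain ⟨M, hM⟩ := hK.exists_bound_of_continuousOn (hf2.continuousOn.mono hsub)
  obtain ⟨M0, hM0⟩ := hK.exists_bound_of_continuousOn (hf.continuousOn.mono hsub)
  obtain ⟨M1, hM1⟩ := hK.exists_bound_of_continuousOn (hf1.continuousOn.mono hsub)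
  refine ⟨|M| + 2 * |M0| / δ ^ 2 + |M1| / δ + 1, by positivity, ?_⟩
  intro x hx b hb
  have hAK : A ⊆ cthickening δ A := self_subset_cthickening A
  by_cases hxb : ‖x - b‖ ≤ δ
  · have hball : closedBall b ‖x - b‖ ⊆ cthickening δ A :=
      (closedBall_subset_closedBall hxb).trans (closedBall_subset_cthickening hb δ)
    have hbm : b ∈ closedBall b ‖x - b‖ := mem_closedBall_self (norm_nonneg _)
    have hxm : x ∈ closedBall b ‖x - b‖ := by simp [mem_closedBall, dist_eq_norm]
    have hb1 : ∀ z ∈ closedBall b ‖x - b‖, ‖deriv f z - deriv f b‖ ≤ |M| * ‖x - b‖ := by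
      intro z hz
      refine (Convex.norm_image_sub_le_of_norm_deriv_le (s := closedBall b ‖x - b‖)
        (fun y hy => (hf1 y (hsub (hball hy))).differentiableAt (hU.mem_nhds (hsub (hball hy))))
        (fun y hy => (hM y (hball hy)).trans (le_abs_self M)) (convex_closedBall _ _) hbm hz).trans ?_
      gcongr
      simpa [mem_closedBall, dist_eq_norm] using hz
    have hg : ∀ z ∈ closedBall b ‖x - b‖, HasDerivAt (fun z => f z - deriv f b * z)
        (deriv f z - deriv f b) z := by
      intro z hz
      have h1 := ((hf z (hsub (hball hz))).differentiableAt (hU.mem_nhds (hsub (hball hz)))).hasDerivAt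
      simpa using h1.fun_sub ((hasDerivAt_id' z).const_mul (deriv f b))
    have := Convex.norm_image_sub_le_of_norm_hasDerivWithin_le
      (fun z hz => (hg z hz).hasDerivWithinAt) hb1 (convex_closedBall _ _) hbm hxm
    calc ‖f x - f b - deriv f b * (x - b)‖
        = ‖f x - deriv f b * x - (f b - deriv f b * b)‖ := by congr 1; ring
      _ ≤ |M| * ‖x - b‖ * ‖x - b‖ := this
      _ = |M| * ‖x - b‖ ^ 2 := by ring
      _ ≤ _ := by
        gcongr
        have : 0 ≤ 2 * |M0| / δ ^ 2 + |M1| / δ + 1 := by positivity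
        linarith
  · push Not at hxb
    have h1 : ‖f x - f b - deriv f b * (x - b)‖ ≤ 2 * |M0| + |M1| * ‖x - b‖ := by
      refine (norm_sub_le _ _).trans ?_
      have ha := (hM0 x (hAK hx)).trans (le_abs_self _)
      have hb' := (hM0 b (hAK hb)).trans (le_abs_self _)
      have hc := (hM1 b (hAK hb)).trans (le_abs_self _)
      have := norm_sub_le (f x) (f b)
      rw [norm_mul]
      have := mul_le_mul_of_nonneg_right hc (norm_nonneg (x - b))
      linarith
    have h2 : 2 * |M0| ≤ 2 * |M0| / δ ^ 2 * ‖x - b‖ ^ 2 := by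
      rw [div_mul_eq_mul_div, le_div_iff₀ (by positivity)]
      gcongr
    have h3 : |M1| * ‖x - b‖ ≤ |M1| / δ * ‖x - b‖ ^ 2 := by
      rw [div_mul_eq_mul_div, le_div_iff₀ (by positivity), sq, ← mul_assoc]
      gcongr
    have : 0 ≤ (|M| + 1) * ‖x - b‖ ^ 2 := by positivity
    nlinarith
    
lemma aux_lower {U A : Set ℂ} (hU : IsOpen U) {f : ℂ → ℂ} (hf : DifferentiableOn ℂ f U)
    (hinj : InjOn f U)
    (hA : IsCompact A) (hAU : A ⊆ U) : ∃ κ : ℝ, 0 < κ ∧ (∀ b ∈ A, κ ≤ ‖deriv f b‖) ∧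
      ∀ x ∈ A, ∀ b ∈ A, κ * ‖x - b‖ ≤ ‖f x - f b‖ := by
  obtain ⟨L, hL, hq⟩ := aux_quad hU hf hA hAU
  rcases A.eq_empty_or_nonempty with rfl | hne
  · exact ⟨1, one_pos, by simp, by simp⟩
  have hf1 := (hf.deriv hU).continuousOn.mono hAU
  obtain ⟨b0, hb0, hmin⟩ := hA.exists_isMinOn hne hf1.norm
  set k := ‖deriv f b0‖ with hk
  have hkpos : 0 < k := norm_pos_iff.2 (aux_deriv_ne_zero hU hf hinj (hAU hb0))
  have hkb : ∀ b ∈ A, k ≤ ‖deriv f b‖ := fun b hb => hmin hb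
  -- near
  have hnear : ∀ x ∈ A, ∀ b ∈ A, ‖x - b‖ ≤ k / (2 * L) → k / 2 * ‖x - b‖ ≤ ‖f x - f b‖ := by
    intro x hx b hb h
    have h1 := hq x hx b hb
    have h2 : ‖deriv f b * (x - b)‖ ≤ ‖f x - f b‖ + ‖f x - f b - deriv f b * (x - b)‖ := by
      rw [← norm_neg (f x - f b - _)]
      refine le_trans (le_of_eq ?_) (norm_add_le _ _)
      congr 1; ring
    rw [norm_mul] at h2
    have h3 := mul_le_mul_of_nonneg_right (hkb b hb) (norm_nonneg (x - b))
    have h4 : L * ‖x - b‖ ^ 2 ≤ k / 2 * ‖x - b‖ := by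
      rw [le_div_iff₀ (by positivity)] at h
      nlinarith [norm_nonneg (x - b)]
    linarith
  set T := (A ×ˢ A) ∩ {p : ℂ × ℂ | k / (2 * L) ≤ ‖p.1 - p.2‖} with hT
  have hTc : IsCompact T := (hA.prod hA).inter_right (isClosed_le (by fun_prop) (by fun_prop))
  have hfA := hf.continuousOn.mono hAU
  have hcont : ContinuousOn (fun p : ℂ × ℂ => ‖f p.1 - f p.2‖ / ‖p.1 - p.2‖) T := by
    refine ContinuousOn.div ?_ (by fun_prop) ?_
    · refine ContinuousOn.norm (ContinuousOn.sub ?_ ?_)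
      · exact hfA.comp continuousOn_fst (fun p hp => hp.1.1)
      · exact hfA.comp continuousOn_snd (fun p hp => hp.1.2)
    · rintro p ⟨_, hp⟩
      have : 0 < k / (2 * L) := by positivity
      exact (this.trans_le hp).ne'
  rcases T.eq_empty_or_nonempty with hTe | hTne
  · refine ⟨k / 2, by positivity, fun b hb => by linarith [hkb b hb], fun x hx b hb => ?_⟩
    refine hnear x hx b hb ?_
    by_contra hcon
    have : (x, b) ∈ T := ⟨⟨hx, hb⟩, (not_le.1 hcon).le⟩
    rw [hTe] at this; exact this
  · obtain ⟨p, hp, hpmin⟩ := hTc.exists_isMinOn hTne hcont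
    set μ := ‖f p.1 - f p.2‖ / ‖p.1 - p.2‖ with hμ
    have hpp : 0 < ‖p.1 - p.2‖ := by
      have : 0 < k / (2 * L) := by positivity
      exact (this.trans_le hp.2)
    have hμpos : 0 < μ := by
      refine div_pos (norm_pos_iff.2 ?_) hpp
      intro h
      have := hinj (hAU hp.1.1) (hAU hp.1.2) (sub_eq_zero.1 h)
      simp [this] at hpp
    refine ⟨min (k / 2) μ, by positivity, fun b hb => ?_, fun x hx b hb => ?_⟩
    · have := min_le_left (k / 2) μ
      linarith [hkb b hb]
    · by_cases h : ‖x - b‖ ≤ k / (2 * L)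
      · refine le_trans ?_ (hnear x hx b hb h)
        gcongr
        exact min_le_left _ _
      · have hm : (x, b) ∈ T := ⟨⟨hx, hb⟩, (not_le.1 h).le⟩
        have h0 : 0 < ‖x - b‖ := lt_trans (by positivity) (not_le.1 h)
        have := hpmin hm
        have h5 : μ ≤ ‖f x - f b‖ / ‖x - b‖ := this
        rw [le_div_iff₀ h0] at h5
        refine le_trans ?_ h5
        gcongr
        exact min_le_right _ _
lemma HolIFS.word_nil (S : HolIFS) (x : ℂ) : S.word [] x = x := rfl

lemma HolIFS.word_cons (S : HolIFS) (i : Fin S.m) (w : List (Fin S.m)) (x : ℂ) :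
    S.word (i :: w) x = S.g i (S.word w x) := rfl

lemma HolIFS.word_append (S : HolIFS) (u v : List (Fin S.m)) (x : ℂ) :
    S.word (u ++ v) x = S.word u (S.word v x) := by
  induction u with
  | nil => rfl
  | cons i u ih => rw [List.cons_append, word_cons, word_cons, ih]

lemma HolIFS.g_mem (S : HolIFS) (i : Fin S.m) {x : ℂ} (hx : x ∈ S.Ω) : S.g i x ∈ S.Ω :=
  S.hcl i (subset_closure (mem_image_of_mem _ hx))

lemma HolIFS.word_mem (S : HolIFS) (w : List (Fin S.m)) {x : ℂ} (hx : x ∈ S.Ω) :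
    S.word w x ∈ S.Ω := by
  induction w with
  | nil => exact hx
  | cons i w ih => exact S.g_mem i ih

lemma HolIFS.word_injOn (S : HolIFS) (w : List (Fin S.m)) : InjOn (S.word w) S.Ω := by
  induction w with
  | nil => exact fun x _ y _ h => h
  | cons i w ih =>
    intro x hx y hy h
    exact ih hx hy (S.hinj i (S.word_mem w hx) (S.word_mem w hy) h)

lemma HolIFS.word_diffAt (S : HolIFS) (w : List (Fin S.m)) {x : ℂ} (hx : x ∈ S.Ω) :
    DifferentiableAt ℂ (S.word w) x := by
  induction w with
  | nil => exact differentiableAt_id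
  | cons i w ih =>
    have h1 : DifferentiableAt ℂ (S.g i) (S.word w x) :=
      (S.hdiff i).differentiableAt (S.hopen.mem_nhds (S.word_mem w hx))
    change DifferentiableAt ℂ (S.g i ∘ S.word w) x
    exact DifferentiableAt.comp x h1 ih

lemma HolIFS.exists_delta (S : HolIFS) : ∃ δ : ℝ, 0 < δ ∧ ∀ i, ∀ p ∈ S.Ω, ∀ z ∈ S.Ω,
    S.g i z + δ * (S.g i z - S.g i p) ∈ S.Ω := by
  have hK : IsCompact (⋃ i, closure (S.g i '' S.Ω)) := by
    refine isCompact_iUnion fun i => ?_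
    refine (S.hbdd.subset ?_).isCompact_closure
    exact subset_closure.trans (S.hcl i)
  obtain ⟨r, hr, hsub⟩ := hK.exists_cthickening_subset_open S.hopen (iUnion_subset S.hcl)
  obtain ⟨R, hR⟩ := S.hbdd.exists_norm_le
  refine ⟨r / (2 * |R| + 1), by positivity, fun i p hp z hz => ?_⟩
  apply hsub
  have hm : S.g i z ∈ ⋃ i, closure (S.g i '' S.Ω) :=
    mem_iUnion.2 ⟨i, subset_closure (mem_image_of_mem _ hz)⟩
  refine closedBall_subset_cthickening hm r ?_
  rw [mem_closedBall, dist_eq_norm, add_sub_cancel_left, norm_mul, Complex.norm_real,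
    Real.norm_of_nonneg (by positivity), div_mul_eq_mul_div, div_le_iff₀ (by positivity)]
  have h1 := (hR _ (S.g_mem i hz)).trans (le_abs_self R)
  have h2 := (hR _ (S.g_mem i hp)).trans (le_abs_self R)
  have h3 := norm_sub_le (S.g i z) (S.g i p)
  gcongr
  linarith

lemma HolIFS.deriv_decay (S : HolIFS) : ∃ q R : ℝ, 0 < q ∧ q < 1 ∧ 0 < R ∧
    ∀ (w : List (Fin S.m)) (x : ℂ) (r : ℝ), 0 < r → closedBall x r ⊆ S.Ω →
      ‖deriv (S.word w) x‖ ≤ R / r * q ^ w.length := by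
  obtain ⟨δ, hδ, hmem⟩ := S.exists_delta
  obtain ⟨R, hR⟩ := S.hbdd.exists_norm_le
  have key : ∀ (w : List (Fin S.m)) (φ : ℂ → ℂ), DifferentiableOn ℂ φ S.Ω → MapsTo φ S.Ω S.Ω →
      ∀ (x : ℂ) (r : ℝ), 0 < r → closedBall x r ⊆ S.Ω →
      (1 + δ) ^ w.length * ‖deriv (fun z => φ (S.word w z)) x‖ ≤ (|R| + 1) / r := by
    intro w
    induction w with
    | nil =>
      intro φ hφ hmap x r hr hball
      simp only [List.length_nil, pow_zero, one_mul]
      refine Complex.norm_deriv_le_of_forall_mem_sphere_norm_le hr ?_ ?_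
      · refine DifferentiableOn.diffContOnCl (s := ball x r) ?_
        refine hφ.mono ?_
        exact closure_ball_subset_closedBall.trans hball
      · intro z hz
        have := hR _ (hmap (hball (sphere_subset_closedBall hz)))
        change ‖φ z‖ ≤ _
        linarith [le_abs_self R]
    | cons i w ih =>
      intro φ hφ hmap x r hr hball
      have hx : x ∈ S.Ω := hball (mem_closedBall_self hr.le)
      set p := S.word w x with hp
      have hpΩ : p ∈ S.Ω := S.word_mem w hx
      let h : ℂ → ℂ := fun z => φ (S.g i z + δ * (S.g i z - S.g i p))
      have hin : DifferentiableOn ℂ (fun z => S.g i z + δ * (S.g i z - S.g i p)) S.Ω :=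
        (S.hdiff i).add (((S.hdiff i).sub_const _).const_mul _)
      have hd : DifferentiableOn ℂ h S.Ω := hφ.comp hin (fun z hz => hmem i p hpΩ z hz)
      have hm : MapsTo h S.Ω S.Ω := fun z hz => hmap (hmem i p hpΩ z hz)
      have h1 := ih h hd hm x r hr hball
      have hgd : HasDerivAt (S.g i) (deriv (S.g i) p) p :=
        ((S.hdiff i).differentiableAt (S.hopen.mem_nhds hpΩ)).hasDerivAt
      have hwd : HasDerivAt (S.word w) (deriv (S.word w) x) x := (S.word_diffAt w hx).hasDerivAt
      have hφd : HasDerivAt φ (deriv φ (S.g i p)) (S.g i p) :=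
        (hφ.differentiableAt (S.hopen.mem_nhds (S.g_mem i hpΩ))).hasDerivAt
      have e0 : HasDerivAt (S.g i ∘ S.word w) (deriv (S.g i) p * deriv (S.word w) x) x :=
        HasDerivAt.comp x hgd hwd
      have e1 : HasDerivAt (fun z => φ (S.word (i :: w) z))
          (deriv φ (S.g i p) * (deriv (S.g i) p * deriv (S.word w) x)) x :=
        HasDerivAt.comp x hφd e0
      have e2 : HasDerivAt (fun z => S.g i z + δ * (S.g i z - S.g i p))
          (deriv (S.g i) p + δ * deriv (S.g i) p) p :=
        hgd.fun_add ((hgd.sub_const _).const_mul _)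
      have hφd' : HasDerivAt φ (deriv φ (S.g i p)) (S.g i p + δ * (S.g i p - S.g i p)) := by
        simpa using hφd
      have e3 : HasDerivAt (fun z => h (S.word w z))
          (deriv φ (S.g i p) * (deriv (S.g i) p + δ * deriv (S.g i) p) * deriv (S.word w) x) x :=
        HasDerivAt.comp x (h₂ := h) (HasDerivAt.comp p hφd' e2) hwd
      rw [e3.deriv] at h1
      rw [e1.deriv]
      have e4 : deriv φ (S.g i p) * (deriv (S.g i) p + δ * deriv (S.g i) p) * deriv (S.word w) x
          = ((1 + δ : ℝ) : ℂ) * (deriv φ (S.g i p) * (deriv (S.g i) p * deriv (S.word w) x)) := by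
        push_cast; ring
      rw [e4, norm_mul, Complex.norm_real, Real.norm_of_nonneg (by positivity)] at h1
      rw [List.length_cons, pow_succ, mul_assoc]
      exact h1
  refine ⟨(1 + δ)⁻¹, |R| + 1, by positivity, inv_lt_one_of_one_lt₀ (by linarith), by positivity, ?_⟩
  intro w x r hr hball
  have := key w id differentiableOn_id (fun z hz => hz) x r hr hball
  rw [inv_pow, ← div_eq_mul_inv, le_div_iff₀ (by positivity), mul_comm]
  exact this

open Filter Topology in
/-- uniform contraction -/
lemma HolIFS.contract (S : HolIFS) : ∃ q : ℝ, 0 < q ∧ q < 1 ∧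
    (∀ x ∈ S.Ω, ∀ y ∈ S.Ω, ∃ C : ℝ, ∀ w : List (Fin S.m),
      ‖S.word w x - S.word w y‖ ≤ C * q ^ w.length) ∧
    ∀ A : Set ℂ, IsCompact A → A ⊆ S.Ω → ∃ C : ℝ, 0 < C ∧ ∀ x ∈ A, ∀ y ∈ A,
      ∀ w : List (Fin S.m), ‖S.word w x - S.word w y‖ ≤ C * q ^ w.length * ‖x - y‖ := by
  obtain ⟨q, R, hq0, hq1, hR, hdec⟩ := S.deriv_decay
  have hloc : ∀ (b : ℂ) (r : ℝ), 0 < r → closedBall b r ⊆ S.Ω → ∀ x ∈ closedBall b (r / 2),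
      ∀ w : List (Fin S.m), ‖S.word w x - S.word w b‖ ≤ 2 * R / r * q ^ w.length * ‖x - b‖ := by
    intro b r hr hball x hx w
    have hsub : ∀ z ∈ closedBall b (r / 2), closedBall z (r / 2) ⊆ S.Ω := by
      intro z hz
      refine Subset.trans ?_ hball
      refine closedBall_subset_closedBall' ?_
      rw [mem_closedBall] at hz
      linarith
    refine Convex.norm_image_sub_le_of_norm_deriv_le (s := closedBall b (r / 2)) (𝕜 := ℂ)
      (fun z hz => S.word_diffAt w (hsub z hz (mem_closedBall_self (by positivity))))
      (fun z hz => ?_) (convex_closedBall _ _) (mem_closedBall_self (by positivity)) hx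
    refine (hdec w z (r / 2) (by positivity) (hsub z hz)).trans (le_of_eq ?_)
    field_simp
  have hexr : ∀ x ∈ S.Ω, ∃ r > 0, closedBall x r ⊆ S.Ω := fun x hx =>
    nhds_basis_closedBall.mem_iff.1 (S.hopen.mem_nhds hx)
  have hlocC : ∀ x ∈ S.Ω, ∃ t ∈ 𝓝 x, ∃ C : ℝ, ∀ y ∈ t, ∀ w : List (Fin S.m),
      ‖S.word w y - S.word w x‖ ≤ C * q ^ w.length := by
    intro x hx
    obtain ⟨r, hr, hball⟩ := hexr x hx
    refine ⟨closedBall x (r / 2), closedBall_mem_nhds _ (by positivity), 2 * R / r * (r / 2), ?_⟩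
    intro y hy w
    refine (hloc x r hr hball y hy w).trans ?_
    rw [mem_closedBall, dist_eq_norm] at hy
    rw [mul_right_comm]
    gcongr
  have hpair : ∀ x ∈ S.Ω, ∀ y ∈ S.Ω, ∃ C : ℝ, ∀ w : List (Fin S.m),
      ‖S.word w x - S.word w y‖ ≤ C * q ^ w.length := by
    intro x hx y hy
    refine S.hconn.isPreconnected.induction₂ (fun x y => ∃ C : ℝ, ∀ w : List (Fin S.m),
      ‖S.word w x - S.word w y‖ ≤ C * q ^ w.length) ?_ ?_ ?_ hx hy
    · intro x hx
      obtain ⟨t, ht, C, hC⟩ := hlocC x hx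
      filter_upwards [mem_nhdsWithin_of_mem_nhds ht] with y hy
      exact ⟨C, fun w => by rw [norm_sub_rev]; exact hC y hy w⟩
    · rintro x y z - - - ⟨C, hC⟩ ⟨C', hC'⟩
      refine ⟨C + C', fun w => ?_⟩
      rw [add_mul]
      exact (norm_sub_le_norm_sub_add_norm_sub _ _ _).trans (add_le_add (hC w) (hC' w))
    · rintro x y - - ⟨C, hC⟩
      exact ⟨C, fun w => by rw [norm_sub_rev]; exact hC w⟩
  refine ⟨q, hq0, hq1, hpair, ?_⟩
  intro A hA hAΩ
  rcases A.eq_empty_or_nonempty with rfl | ⟨x0, hx0⟩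
  · exact ⟨1, one_pos, by simp⟩
  have hunif : ∃ C : ℝ, 0 ≤ C ∧ ∀ y ∈ A, ∀ w : List (Fin S.m),
      ‖S.word w y - S.word w x0‖ ≤ C * q ^ w.length := by
    refine hA.induction_on (p := fun s => ∃ C : ℝ, 0 ≤ C ∧ ∀ y ∈ s, ∀ w : List (Fin S.m),
      ‖S.word w y - S.word w x0‖ ≤ C * q ^ w.length) ⟨0, le_rfl, by simp⟩ ?_ ?_ ?_
    · rintro s t hst ⟨C, hC0, hC⟩
      exact ⟨C, hC0, fun y hy => hC y (hst hy)⟩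
    · rintro s t ⟨C, hC0, hC⟩ ⟨C', hC0', hC'⟩
      refine ⟨C + C', by positivity, ?_⟩
      rintro y (hy | hy) w
      · refine (hC y hy w).trans ?_
        gcongr; linarith
      · refine (hC' y hy w).trans ?_
        gcongr; linarith
    · intro x hx
      obtain ⟨t, ht, C, hC⟩ := hlocC x (hAΩ hx)
      obtain ⟨C', hC'⟩ := hpair x (hAΩ hx) x0 (hAΩ hx0)
      refine ⟨t, mem_nhdsWithin_of_mem_nhds ht, |C| + |C'|, by positivity, fun y hy w => ?_⟩
      have h1 := (norm_sub_le_norm_sub_add_norm_sub (S.word w y) (S.word w x) (S.word w x0)).trans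
        (add_le_add (hC y hy w) (hC' w))
      refine h1.trans ?_
      rw [← add_mul]
      gcongr
      exact le_abs_self _
      exact le_abs_self _
  obtain ⟨C0, hC0, hC⟩ := hunif
  obtain ⟨r, hr, hsub⟩ := hA.exists_cthickening_subset_open S.hopen hAΩ
  refine ⟨2 * R / r + 2 * C0 / (r / 2), by positivity, fun x hx y hy w => ?_⟩
  by_cases hxy : ‖x - y‖ ≤ r / 2
  · refine (hloc y r hr ((closedBall_subset_cthickening hy r).trans hsub) x
      (by rwa [mem_closedBall, dist_eq_norm]) w).trans ?_
    gcongr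
    have : 0 ≤ 2 * C0 / (r / 2) := by positivity
    linarith
  · push Not at hxy
    have h1 := norm_sub_le_norm_sub_add_norm_sub (S.word w x) (S.word w x0) (S.word w y)
    have h2 := hC x hx w
    have h3 := hC y hy w
    rw [norm_sub_rev] at h3
    have h4 : ‖S.word w x - S.word w y‖ ≤ 2 * C0 * q ^ w.length := by linarith
    have h5 : 2 * C0 * q ^ w.length ≤ 2 * C0 / (r / 2) * q ^ w.length * ‖x - y‖ := by
      have h8 : 2 * C0 ≤ 2 * C0 / (r / 2) * ‖x - y‖ := by
        rw [div_mul_eq_mul_div, le_div_iff₀ (by positivity)]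
        gcongr
      have h9 := mul_le_mul_of_nonneg_right h8 (pow_pos hq0 w.length).le
      exact h9.trans_eq (mul_right_comm _ _ _)
    have h6 : 0 ≤ 2 * R / r * q ^ w.length * ‖x - y‖ := by positivity
    have h7 : (2 * R / r + 2 * C0 / (r / 2)) * q ^ w.length * ‖x - y‖ =
      2 * R / r * q ^ w.length * ‖x - y‖ + 2 * C0 / (r / 2) * q ^ w.length * ‖x - y‖ := by ring
    linarith

lemma HolIFS.IsAttractor.g_mem {S : HolIFS} {A : Set ℂ} (hA : S.IsAttractor A) (i : Fin S.m) {x : ℂ}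
    (hx : x ∈ A) : S.g i x ∈ A := by
  rw [hA.2.2.2]
  exact mem_iUnion.2 ⟨i, mem_image_of_mem _ hx⟩

lemma HolIFS.IsAttractor.word_mem {S : HolIFS} {A : Set ℂ} (hA : S.IsAttractor A)
    (w : List (Fin S.m)) {x : ℂ} (hx : x ∈ A) : S.word w x ∈ A := by
  induction w with
  | nil => exact hx
  | cons i w ih => exact hA.g_mem i ih

lemma HolIFS.IsAttractor.pre {S : HolIFS} {A : Set ℂ} (hA : S.IsAttractor A) {x : ℂ}
    (hx : x ∈ A) : ∃ i, ∃ b ∈ A, S.g i b = x := by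
  rw [hA.2.2.2] at hx
  obtain ⟨i, b, hb, rfl⟩ := mem_iUnion.1 hx
  exact ⟨i, b, hb, rfl⟩

lemma HolIFS.IsAttractor.pre_word {S : HolIFS} {A : Set ℂ} (hA : S.IsAttractor A) (n : ℕ) {x : ℂ}
    (hx : x ∈ A) : ∃ w : List (Fin S.m), w.length = n ∧ ∃ b ∈ A, S.word w b = x := by
  induction n generalizing x with
  | zero => exact ⟨[], rfl, x, hx, rfl⟩
  | succ n ih =>
    obtain ⟨i, y, hy, rfl⟩ := hA.pre hx
    obtain ⟨w, hw, b, hb, rfl⟩ := ih hy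
    exact ⟨i :: w, by simp [hw], b, hb, rfl⟩

lemma HolIFS.iter_word (S : HolIFS) {w : List (Fin S.m)} (hw : w ≠ []) (k : ℕ) :
    ∃ u : List (Fin S.m), k ≤ u.length ∧ ∀ x, S.word u x = (S.word w)^[k] x := by
  induction k with
  | zero => exact ⟨[], by simp, fun x => rfl⟩
  | succ k ih =>
    obtain ⟨u, hu, h⟩ := ih
    refine ⟨u ++ w, ?_, fun x => ?_⟩
    · have := List.length_pos_of_ne_nil hw
      simp; omega
    · rw [S.word_append, h, Function.iterate_succ_apply]

open Filter Topology in
lemma HolIFS.IsAttractor.per_subset {S : HolIFS} {A : Set ℂ} (hA : S.IsAttractor A) :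
    S.Per ⊆ A := by
  rintro β ⟨hβ, w, hw, hfix⟩
  obtain ⟨a, ha⟩ := hA.1
  obtain ⟨q, hq0, hq1, hpair, -⟩ := S.contract
  obtain ⟨C, hC⟩ := hpair a (hA.2.2.1 ha) β hβ
  choose u hu1 hu2 using S.iter_word hw
  have hfix' : ∀ k, S.word (u k) β = β := fun k => by
    rw [hu2]; exact (Function.IsFixedPt.iterate hfix k)
  have hlim : Tendsto (fun k => S.word (u k) a) atTop (𝓝 β) := by
    rw [tendsto_iff_norm_sub_tendsto_zero]
    have h0 : Tendsto (fun k : ℕ => |C| * q ^ k) atTop (𝓝 0) := by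
      simpa using (tendsto_pow_atTop_nhds_zero_of_lt_one hq0.le hq1).const_mul |C|
    refine squeeze_zero (fun _ => norm_nonneg _) (fun k => ?_) h0
    have := hC (u k)
    rw [hfix'] at this
    refine this.trans ?_
    have h1 : q ^ (u k).length ≤ q ^ k := pow_le_pow_of_le_one hq0.le hq1.le (hu1 k)
    have h2 := le_abs_self C
    gcongr
  exact hA.2.1.isClosed.mem_of_tendsto hlim (Eventually.of_forall fun k => hA.word_mem _ ha)

lemma HolIFS.IsAttractor.prep_subset {S : HolIFS} {A : Set ℂ} (hA : S.IsAttractor A) :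
    S.Prep ⊆ A := by
  rintro y ⟨w, x, hx, rfl⟩
  exact hA.word_mem w (hA.per_subset hx)

lemma HolIFS.IsAttractor.word_cont {S : HolIFS} {A : Set ℂ} (hA : S.IsAttractor A)
    (w : List (Fin S.m)) : ContinuousOn (S.word w) A := fun _ hx =>
  (S.word_diffAt w (hA.2.2.1 hx)).continuousAt.continuousWithinAt

lemma HolIFS.IsAttractor.exists_fix {S : HolIFS} {A : Set ℂ} (hA : S.IsAttractor A)
    {w : List (Fin S.m)} (hw : w ≠ []) : ∃ p ∈ A, S.word w p = p := by
  obtain ⟨q, hq0, hq1, -, hcon⟩ := S.contract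
  obtain ⟨C, hC0, hC⟩ := hcon A hA.2.1 hA.2.2.1
  obtain ⟨p, hp, hmin⟩ := hA.2.1.exists_isMinOn hA.1
    ((continuousOn_id.sub (hA.word_cont w)).norm)
  refine ⟨p, hp, ?_⟩
  obtain ⟨k, hk⟩ := exists_pow_lt_of_lt_one (show 0 < C⁻¹ by positivity) hq1
  obtain ⟨u, hu1, hu2⟩ := S.iter_word hw k
  have h1 := hC p hp (S.word w p) (hA.word_mem w hp) u
  have h2 : S.word u (S.word w p) = S.word w (S.word u p) := by
    rw [hu2, hu2, ← Function.iterate_succ_apply, Function.iterate_succ_apply']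
  rw [h2] at h1
  have h3 : ‖p - S.word w p‖ ≤ ‖S.word u p - S.word w (S.word u p)‖ := hmin (hA.word_mem u hp)
  by_contra hne
  have h4 : 0 < ‖p - S.word w p‖ := norm_pos_iff.2 (sub_ne_zero.2 (Ne.symm hne))
  have h5 : q ^ u.length ≤ q ^ k := pow_le_pow_of_le_one hq0.le hq1.le hu1
  have h6 : C * q ^ u.length < 1 := by
    calc C * q ^ u.length ≤ C * q ^ k := by gcongr
      _ < C * C⁻¹ := by gcongr
      _ = 1 := mul_inv_cancel₀ hC0.ne'
  nlinarith

lemma HolIFS.IsAttractor.bdd {S : HolIFS} {A : Set ℂ} (hA : S.IsAttractor A) :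
    ∃ Δ : ℝ, 0 < Δ ∧ ∀ x ∈ A, ∀ y ∈ A, ‖x - y‖ ≤ Δ := by
  obtain ⟨R, hR⟩ := hA.2.1.isBounded.exists_norm_le
  refine ⟨2 * |R| + 1, by positivity, fun x hx y hy => ?_⟩
  have h1 := (hR _ hx).trans (le_abs_self R)
  have h2 := (hR _ hy).trans (le_abs_self R)
  have h3 := norm_sub_le x y
  linarith

lemma HolIFS.IsAttractor.closure_prep {S : HolIFS} {A : Set ℂ} (hA : S.IsAttractor A) :
    closure S.Prep = A := by
  refine Subset.antisymm (closure_minimal hA.prep_subset hA.2.1.isClosed) ?_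
  intro x hx
  rw [Metric.mem_closure_iff]
  intro ε hε
  obtain ⟨q, hq0, hq1, -, hcon⟩ := S.contract
  obtain ⟨C, hC0, hC⟩ := hcon A hA.2.1 hA.2.2.1
  obtain ⟨Δ, hΔ, hd⟩ := hA.bdd
  obtain ⟨k, hk⟩ := exists_pow_lt_of_lt_one (show 0 < ε / (C * Δ) by positivity) hq1
  obtain ⟨w, hw, b, hb, rfl⟩ := hA.pre_word (k + 1) hx
  have hw0 : w ≠ [] := by rintro rfl; simp at hw
  obtain ⟨p, hp, hfix⟩ := hA.exists_fix hw0
  refine ⟨p, ⟨[], p, ⟨hA.2.2.1 hp, w, hw0, hfix⟩, rfl⟩, ?_⟩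
  rw [dist_eq_norm]
  have h1 := hC b hb p hp w
  rw [hfix] at h1
  refine h1.trans_lt ?_
  rw [lt_div_iff₀ (by positivity)] at hk
  have h5 : q ^ w.length ≤ q ^ k := pow_le_pow_of_le_one hq0.le hq1.le (by omega)
  calc C * q ^ w.length * ‖b - p‖ ≤ C * q ^ k * Δ := by
        gcongr; exact hd b hb p hp
    _ = q ^ k * (C * Δ) := by ring
    _ < ε := hk

lemma HolIFS.SSC.word_ext {S : HolIFS} {A : Set ℂ} (hA : S.IsAttractor A) (hS : S.SSC A)
    (u u' : List (Fin S.m)) {b b' : ℂ} (hb : b ∈ A) (hb' : b' ∈ A) (hle : u.length ≤ u'.length)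
    (h : S.word u b = S.word u' b') : ∃ v, u' = u ++ v ∧ S.word v b' = b := by
  induction u generalizing u' with
  | nil => exact ⟨u', rfl, h.symm⟩
  | cons i u ih =>
    cases u' with
    | nil => simp at hle
    | cons j u' =>
      have hij : i = j := by
        by_contra hne
        exact (Set.disjoint_left.1 (hS i j hne)) (mem_image_of_mem _ (hA.word_mem u hb))
          ⟨S.word u' b', hA.word_mem u' hb', h.symm⟩
      subst hij
      have h2 := S.hinj i (hA.2.2.1 (hA.word_mem u hb)) (hA.2.2.1 (hA.word_mem u' hb')) h
      obtain ⟨v, rfl, hv⟩ := ih u' (by simpa using hle) h2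
      exact ⟨v, rfl, hv⟩

/-- multiplier product -/
def HolIFS.D (S : HolIFS) : List (Fin S.m) → ℂ → ℂ
  | [], _ => 1
  | i :: w, b => deriv (S.g i) (S.word w b) * HolIFS.D S w b

lemma HolIFS.D_append (S : HolIFS) (u v : List (Fin S.m)) (b : ℂ) :
    S.D (u ++ v) b = S.D u (S.word v b) * S.D v b := by
  induction u with
  | nil => simp [D]
  | cons i u ih => rw [List.cons_append, D, D, ih, S.word_append, mul_assoc]

lemma HolIFS.SSC.sep {S : HolIFS} {A : Set ℂ} (hA : S.IsAttractor A) (hS : S.SSC A) :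
    ∃ σ : ℝ, 0 < σ ∧ ∀ i j, i ≠ j → ∀ x ∈ A, ∀ y ∈ A, σ ≤ ‖S.g i x - S.g j y‖ := by
  have h : ∀ p : Fin S.m × Fin S.m, ∃ σ : ℝ, 0 < σ ∧ (p.1 ≠ p.2 → ∀ x ∈ A, ∀ y ∈ A,
      σ ≤ ‖S.g p.1 x - S.g p.2 y‖) := by
    rintro ⟨i, j⟩
    by_cases hij : i = j
    · exact ⟨1, one_pos, fun h => absurd hij h⟩
    have hc : ∀ i, IsCompact (S.g i '' A) := fun i =>
      hA.2.1.image_of_continuousOn (hA.word_cont [i])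
    obtain ⟨δ, hδ, hdis⟩ := (hS i j hij).exists_thickenings (hc i) (hc j).isClosed
    refine ⟨δ, hδ, fun _ x hx y hy => ?_⟩
    by_contra hcon
    push Not at hcon
    refine Set.disjoint_left.1 hdis (self_subset_thickening hδ _ (mem_image_of_mem _ hx)) ?_
    rw [mem_thickening_iff]
    exact ⟨S.g j y, mem_image_of_mem _ hy, by rwa [dist_eq_norm]⟩
  choose σ hσ0 hσ using h
  have : Nonempty (Fin S.m) := ⟨⟨0, S.hm⟩⟩
  obtain ⟨p0, hp0⟩ := Finite.exists_min σ
  exact ⟨σ p0, hσ0 p0, fun i j hij x hx y hy => (hp0 (i, j)).trans (hσ (i, j) hij x hx y hy)⟩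

lemma HolIFS.IsAttractor.alt {S : HolIFS} {A : Set ℂ} (hA : S.IsAttractor A)
    (w : List (Fin S.m)) {a : ℂ} (ha : a ∈ A) : (∃ x ∈ A, S.word w x = a) ∨
      ∃ v i w' j, w = v ++ i :: w' ∧ j ≠ i ∧ ∃ x ∈ A, a = S.word v (S.g j x) := by
  induction w generalizing a with
  | nil => exact Or.inl ⟨a, ha, rfl⟩
  | cons i w ih =>
    obtain ⟨j, a', ha', rfl⟩ := hA.pre ha
    by_cases hij : j = i
    · subst hij
      rcases ih ha' with ⟨x, hx, rfl⟩ | ⟨v, i', w', j', rfl, hne, x, hx, rfl⟩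
      · exact Or.inl ⟨x, hx, rfl⟩
      · exact Or.inr ⟨j :: v, i', w', j', rfl, hne, x, hx, rfl⟩
    · exact Or.inr ⟨[], i, w, j, rfl, hij, a', ha', rfl⟩

/-- the one-step estimates, uniform in `i` -/
lemma HolIFS.IsAttractor.one_step {S : HolIFS} {A : Set ℂ} (hA : S.IsAttractor A) :
    ∃ L κ : ℝ, 0 < L ∧ 0 < κ ∧ (∀ i, ∀ b ∈ A, κ ≤ ‖deriv (S.g i) b‖) ∧
      (∀ i, ∀ x ∈ A, ∀ b ∈ A, κ * ‖x - b‖ ≤ ‖S.g i x - S.g i b‖) ∧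
      (∀ i, ∀ x ∈ A, ∀ b ∈ A,
        ‖S.g i x - S.g i b - deriv (S.g i) b * (x - b)‖ ≤ L * ‖x - b‖ ^ 2) := by
  have : Nonempty (Fin S.m) := ⟨⟨0, S.hm⟩⟩
  choose L hL0 hL using fun i => aux_quad S.hopen (S.hdiff i) hA.2.1 hA.2.2.1
  choose κ hκ0 hκ1 hκ2 using fun i => aux_lower S.hopen (S.hdiff i) (S.hinj i) hA.2.1 hA.2.2.1
  obtain ⟨i0, hi0⟩ := Finite.exists_max L
  obtain ⟨j0, hj0⟩ := Finite.exists_min κ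
  refine ⟨L i0, κ j0, hL0 _, hκ0 _, fun i b hb => (hj0 i).trans (hκ1 i b hb),
    fun i x hx b hb => le_trans ?_ (hκ2 i x hx b hb), fun i x hx b hb => (hL i x hx b hb).trans ?_⟩
  · gcongr; exact hj0 i
  · gcongr; exact hi0 i

lemma HolIFS.IsAttractor.D_ne {S : HolIFS} {A : Set ℂ} (hA : S.IsAttractor A)
    (w : List (Fin S.m)) {b : ℂ} (hb : b ∈ A) : S.D w b ≠ 0 := by
  induction w with
  | nil => exact one_ne_zero
  | cons i w ih =>
    exact mul_ne_zero (aux_deriv_ne_zero S.hopen (S.hdiff i) (S.hinj i)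
      (hA.2.2.1 (hA.word_mem w hb))) ih

/-- distortion estimates for all words -/
lemma HolIFS.IsAttractor.distort {S : HolIFS} {A : Set ℂ} (hA : S.IsAttractor A)
    (hA2 : A.Nontrivial) :
    ∃ E q : ℝ, 0 < E ∧ 0 < q ∧ q < 1 ∧ ∀ w : List (Fin S.m), ∀ b ∈ A,
      ‖S.D w b‖ ≤ E * q ^ w.length ∧ ∀ x ∈ A,
      ‖S.D w b‖ * ‖x - b‖ ≤ E * ‖S.word w x - S.word w b‖ ∧
      ‖S.word w x - S.word w b‖ ≤ E * (‖S.D w b‖ * ‖x - b‖) ∧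
      ‖S.word w x - S.word w b - S.D w b * (x - b)‖ ≤ E * (‖S.D w b‖ * ‖x - b‖ ^ 2) := by
  obtain ⟨q, hq0, hq1, -, hcon⟩ := S.contract
  obtain ⟨C, hC0, hC⟩ := hcon A hA.2.1 hA.2.2.1
  obtain ⟨Δ, hΔ, hd⟩ := hA.bdd
  obtain ⟨L, κ, hL, hκ, h1, h2, h3⟩ := hA.one_step
  set s : ℕ → ℝ := fun n => (1 - q ^ n) / (1 - q) with hs
  have h1q : 0 < 1 - q := by linarith
  have hs0 : s 0 = 0 := by simp [hs]
  have hsS : ∀ n, s (n + 1) = s n + q ^ n := by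
    intro n; simp only [hs]; field_simp; ring
  have hsle : ∀ n, s n ≤ 1 / (1 - q) := by
    intro n
    have := pow_pos hq0 n
    simp only [hs]; gcongr; linarith
  set M := L / κ * (C * Δ) with hM
  have hM0 : 0 < M := by positivity
  -- one step factor
  have hstep : ∀ (w : List (Fin S.m)), ∀ x ∈ A, ∀ b ∈ A,
      1 + L / κ * ‖S.word w x - S.word w b‖ ≤ Real.exp (M * q ^ w.length) := by
    intro w x hx b hb
    have e1 : L / κ * ‖S.word w x - S.word w b‖ ≤ M * q ^ w.length := by
      have := hC x hx b hb w
      calc L / κ * ‖S.word w x - S.word w b‖ ≤ L / κ * (C * q ^ w.length * Δ) := by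
            gcongr
            refine this.trans ?_
            gcongr
            exact hd x hx b hb
        _ = M * q ^ w.length := by rw [hM]; ring
    have := Real.add_one_le_exp (M * q ^ w.length)
    linarith
  have hlow : ∀ (w : List (Fin S.m)), ∀ x ∈ A, ∀ b ∈ A,
      ‖S.D w b‖ * ‖x - b‖ ≤ Real.exp (M * s w.length) * ‖S.word w x - S.word w b‖ := by
    intro w x hx b hb
    induction w with
    | nil => simp [HolIFS.D, hs0, HolIFS.word_nil]
    | cons i w ih =>
      have hx' := hA.word_mem w hx
      have hb' := hA.word_mem w hb
      set p := S.word w x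
      set p' := S.word w b
      have e1 : ‖deriv (S.g i) p'‖ * ‖p - p'‖ ≤
          (1 + L / κ * ‖p - p'‖) * ‖S.g i p - S.g i p'‖ := by
        have a1 := h3 i p hx' p' hb'
        have a2 := h2 i p hx' p' hb'
        have a3 : ‖deriv (S.g i) p' * (p - p')‖ ≤ ‖S.g i p - S.g i p'‖ +
            ‖S.g i p - S.g i p' - deriv (S.g i) p' * (p - p')‖ := by
          rw [← norm_neg (S.g i p - S.g i p' - _)]
          refine le_trans (le_of_eq ?_) (norm_add_le _ _)
          congr 1; ring
        rw [norm_mul] at a3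
        have a4 : L * ‖p - p'‖ ^ 2 ≤ L / κ * ‖p - p'‖ * ‖S.g i p - S.g i p'‖ := by
          calc L * ‖p - p'‖ ^ 2 = L / κ * ‖p - p'‖ * (κ * ‖p - p'‖) := by field_simp
            _ ≤ _ := by gcongr
        linarith
      have e2 := hstep w x hx b hb
      rw [HolIFS.D, norm_mul, S.word_cons, S.word_cons, List.length_cons, hsS, mul_add, Real.exp_add]
      calc ‖deriv (S.g i) p'‖ * ‖S.D w b‖ * ‖x - b‖
          = ‖deriv (S.g i) p'‖ * (‖S.D w b‖ * ‖x - b‖) := by ring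
        _ ≤ ‖deriv (S.g i) p'‖ * (Real.exp (M * s w.length) * ‖p - p'‖) := by gcongr
        _ = Real.exp (M * s w.length) * (‖deriv (S.g i) p'‖ * ‖p - p'‖) := by ring
        _ ≤ Real.exp (M * s w.length) * (Real.exp (M * q ^ w.length) * ‖S.g i p - S.g i p'‖) := by
          refine mul_le_mul_of_nonneg_left (e1.trans ?_) (Real.exp_pos _).le
          gcongr
        _ = _ := by ring
  have hup : ∀ (w : List (Fin S.m)), ∀ x ∈ A, ∀ b ∈ A,
      ‖S.word w x - S.word w b‖ ≤ Real.exp (M * s w.length) * (‖S.D w b‖ * ‖x - b‖) := by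
    intro w x hx b hb
    induction w with
    | nil => simp [HolIFS.D, hs0, HolIFS.word_nil]
    | cons i w ih =>
      have hx' := hA.word_mem w hx
      have hb' := hA.word_mem w hb
      set p := S.word w x
      set p' := S.word w b
      have e1 : ‖S.g i p - S.g i p'‖ ≤ 
          (1 + L / κ * ‖p - p'‖) * (‖deriv (S.g i) p'‖ * ‖p - p'‖) := by
        have a1 := h3 i p hx' p' hb'
        have a2 := h1 i p' hb'
        have a3 : ‖S.g i p - S.g i p'‖ ≤ ‖deriv (S.g i) p' * (p - p')‖ + 
            ‖S.g i p - S.g i p' - deriv (S.g i) p' * (p - p')‖ := by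
          refine le_trans (le_of_eq ?_) (norm_add_le _ _)
          congr 1; ring
        rw [norm_mul] at a3
        have a4 : L * ‖p - p'‖ ^ 2 ≤ L / κ * ‖p - p'‖ * (‖deriv (S.g i) p'‖ * ‖p - p'‖) := by
          calc L * ‖p - p'‖ ^ 2 = L / κ * ‖p - p'‖ * (κ * ‖p - p'‖) := by field_simp
            _ ≤ _ := by gcongr
        linarith
      have e2 := hstep w x hx b hb
      rw [HolIFS.D, norm_mul, S.word_cons, S.word_cons, List.length_cons, hsS, mul_add, Real.exp_add]
      calc ‖S.g i p - S.g i p'‖ ≤ (1 + L / κ * ‖p - p'‖) * (‖deriv (S.g i) p'‖ * ‖p - p'‖) := e1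
        _ ≤ Real.exp (M * q ^ w.length) * (‖deriv (S.g i) p'‖ *
            (Real.exp (M * s w.length) * (‖S.D w b‖ * ‖x - b‖))) := by gcongr
        _ = _ := by ring
  set E0 := Real.exp (M / (1 - q)) with hE0
  have hE0pos : 0 < E0 := Real.exp_pos _
  have hexp : ∀ n, Real.exp (M * s n) ≤ E0 := by
    intro n
    apply Real.exp_le_exp.2
    calc M * s n ≤ M * (1 / (1 - q)) := by gcongr; exact hsle n
      _ = _ := by ring
  set B := L * C * E0 / κ with hB
  have hB0 : 0 < B := by positivity
  have hquad : ∀ (w : List (Fin S.m)), ∀ x ∈ A, ∀ b ∈ A,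
      ‖S.word w x - S.word w b - S.D w b * (x - b)‖ ≤
        B * s w.length * (‖S.D w b‖ * ‖x - b‖ ^ 2) := by
    intro w x hx b hb
    induction w with
    | nil => simp [HolIFS.D, hs0, HolIFS.word_nil]
    | cons i w ih =>
      have hx' := hA.word_mem w hx
      have hb' := hA.word_mem w hb
      have u1 := hC x hx b hb w
      have u2 : ‖S.word w x - S.word w b‖ ≤ E0 * (‖S.D w b‖ * ‖x - b‖) :=
        (hup w x hx b hb).trans (by gcongr; exact hexp _)
      rw [S.word_cons, S.word_cons, HolIFS.D, List.length_cons, hsS]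
      set p := S.word w x
      set p' := S.word w b
      have a1 := h3 i p hx' p' hb'
      have a2 := h1 i p' hb'
      have e1 : S.g i p - S.g i p' - deriv (S.g i) p' * S.D w b * (x - b) =
          (S.g i p - S.g i p' - deriv (S.g i) p' * (p - p')) +
          deriv (S.g i) p' * (p - p' - S.D w b * (x - b)) := by ring
      rw [e1]
      refine (norm_add_le _ _).trans ?_
      rw [norm_mul, norm_mul]
      have e2 : L * ‖p - p'‖ ^ 2 ≤
          B * q ^ w.length * (‖deriv (S.g i) p'‖ * ‖S.D w b‖ * ‖x - b‖ ^ 2) := by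
        calc L * ‖p - p'‖ ^ 2 = L * (‖p - p'‖ * ‖p - p'‖) := by ring
          _ ≤ L * ((C * q ^ w.length * ‖x - b‖) * (E0 * (‖S.D w b‖ * ‖x - b‖))) := by gcongr
          _ = B * q ^ w.length * (κ * ‖S.D w b‖ * ‖x - b‖ ^ 2) := by rw [hB]; field_simp
          _ ≤ _ := by gcongr
      have e3 : ‖deriv (S.g i) p'‖ * ‖p - p' - S.D w b * (x - b)‖ ≤
          ‖deriv (S.g i) p'‖ * (B * s w.length * (‖S.D w b‖ * ‖x - b‖ ^ 2)) := by gcongr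
      calc _ ≤ B * q ^ w.length * (‖deriv (S.g i) p'‖ * ‖S.D w b‖ * ‖x - b‖ ^ 2) +
          ‖deriv (S.g i) p'‖ * (B * s w.length * (‖S.D w b‖ * ‖x - b‖ ^ 2)) :=
            add_le_add (a1.trans e2) e3
        _ = _ := by ring
  refine ⟨E0 * C + E0 + B * (1 / (1 - q)), q, by positivity, hq0, hq1, fun w b hb => ⟨?_, fun x hx => ⟨?_, ?_, ?_⟩⟩⟩
  · obtain ⟨x, hx, hxb⟩ := hA2.exists_ne b
    have hpos : 0 < ‖x - b‖ := norm_pos_iff.2 (sub_ne_zero.2 hxb)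
    have a1 := hlow w x hx b hb
    have a2 := hC x hx b hb w
    have a3 : ‖S.D w b‖ * ‖x - b‖ ≤ E0 * C * q ^ w.length * ‖x - b‖ := by
      calc _ ≤ _ := a1
        _ ≤ E0 * (C * q ^ w.length * ‖x - b‖) := by gcongr; exact hexp _
        _ = _ := by ring
    refine (le_of_mul_le_mul_right a3 hpos).trans ?_
    gcongr
    have : 0 ≤ B * (1 / (1 - q)) := by positivity
    linarith
  · refine (hlow w x hx b hb).trans ?_
    gcongr
    have := hexp w.length
    have : 0 ≤ B * (1 / (1 - q)) := by positivity
    have : 0 ≤ E0 * C := by positivity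
    linarith
  · refine (hup w x hx b hb).trans ?_
    gcongr
    have := hexp w.length
    have : 0 ≤ B * (1 / (1 - q)) := by positivity
    have : 0 ≤ E0 * C := by positivity
    linarith
  · refine (hquad w x hx b hb).trans ?_
    gcongr
    have : B * s w.length ≤ B * (1 / (1 - q)) := by gcongr; exact hsle _
    have : 0 ≤ E0 * C := by positivity
    linarith

/-- everything needed about one IFS -/
lemma HolIFS.SSC.pack {S : HolIFS} {A : Set ℂ} (hA : S.IsAttractor A)
    (hA2 : A.Nontrivial) (hS : S.SSC A) :
    ∃ c C κ q : ℝ, 0 < c ∧ 0 < C ∧ 0 < κ ∧ 0 < q ∧ q < 1 ∧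
      (∀ w : List (Fin S.m), ∀ b ∈ A, ‖S.D w b‖ ≤ C * q ^ w.length) ∧
      (∀ w : List (Fin S.m), ∀ b ∈ A, ∀ x ∈ A,
        ‖S.word w x - S.word w b - S.D w b * (x - b)‖ ≤ C * (‖S.D w b‖ * ‖x - b‖ ^ 2)) ∧
      (∀ w : List (Fin S.m), ∀ b ∈ A, ∀ x ∈ A,
        ‖S.word w x - S.word w b‖ ≤ C * (‖S.D w b‖ * ‖x - b‖)) ∧
      (∀ w : List (Fin S.m), ∀ b ∈ A, ∀ a ∈ A, ‖a - S.word w b‖ ≤ c * ‖S.D w b‖ →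
        ∃ x ∈ A, S.word w x = a ∧ c * ‖S.D w b‖ * ‖x - b‖ ≤ ‖a - S.word w b‖) ∧
      (∀ w : List (Fin S.m), ∀ b ∈ A, ∀ x ∈ A, ‖S.D w b‖ ≤ C * ‖S.D w x‖) ∧
      (∀ y ∈ A, ∀ T : ℝ, 0 < T → T < 1 → ∃ u : List (Fin S.m), ∃ b ∈ A, S.word u b = y ∧
        κ * T ≤ ‖S.D u b‖ ∧ ‖S.D u b‖ ≤ T) := by
  obtain ⟨E, q, hE, hq0, hq1, hdis⟩ := hA.distort hA2
  obtain ⟨L, κ, hL, hκ, h1, h2, h3⟩ := hA.one_step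
  obtain ⟨σ, hσ, hsep⟩ := hS.sep hA
  refine ⟨min (σ / (2 * E * E)) (1 / E), E + E * E + 1, κ, q, by positivity, by positivity, hκ, hq0, hq1,
    ?_, ?_, ?_, ?_, ?_, ?_⟩
  · intro w b hb
    refine (hdis w b hb).1.trans ?_
    gcongr
    nlinarith
  · intro w b hb x hx
    refine ((hdis w b hb).2 x hx).2.2.trans ?_
    gcongr
    nlinarith
  · intro w b hb x hx
    refine ((hdis w b hb).2 x hx).2.1.trans ?_
    gcongr
    nlinarith
  · intro w b hb a ha hle
    have hDpos : 0 < ‖S.D w b‖ := norm_pos_iff.2 (hA.D_ne w hb)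
    rcases hA.alt w ha with ⟨x, hx, rfl⟩ | ⟨v, i, w', j, rfl, hne, x, hx, rfl⟩
    · refine ⟨x, hx, rfl, ?_⟩
      have a1 := ((hdis w b hb).2 x hx).1
      calc min (σ / (2 * E * E)) (1 / E) * ‖S.D w b‖ * ‖x - b‖
          ≤ 1 / E * ‖S.D w b‖ * ‖x - b‖ := by gcongr; exact min_le_right _ _
        _ = 1 / E * (‖S.D w b‖ * ‖x - b‖) := by ring
        _ ≤ 1 / E * (E * ‖S.word w x - S.word w b‖) := by gcongr
        _ = _ := by field_simp
    · exfalso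
      rw [S.word_append, S.D_append] at hle
      rw [S.D_append] at hDpos
      set p := S.word (i :: w') b with hp
      have hpA : p ∈ A := hA.word_mem _ hb
      have a1 := ((hdis v p hpA).2 (S.g j x) (hA.g_mem j hx)).1
      have a2 : σ ≤ ‖S.g j x - p‖ := hsep j i hne x hx _ (hA.word_mem w' hb)
      have a3 : ‖S.D (i :: w') b‖ ≤ E := by
        refine (hdis (i :: w') b hb).1.trans ?_
        have := pow_le_one₀ hq0.le hq1.le (n := (i :: w').length)
        nlinarith
      rw [norm_mul] at hle hDpos
      have hvpos : 0 < ‖S.D v p‖ := norm_pos_iff.2 (hA.D_ne v hpA)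
      have a4 : ‖S.D v p‖ * σ ≤ ‖S.D v p‖ * (σ / 2) := by
        calc ‖S.D v p‖ * σ ≤ ‖S.D v p‖ * ‖S.g j x - p‖ := by gcongr
          _ ≤ E * ‖S.word v (S.g j x) - S.word v p‖ := a1
          _ ≤ E * (min (σ / (2 * E * E)) (1 / E) * (‖S.D v p‖ * ‖S.D (i :: w') b‖)) := by gcongr
          _ ≤ E * (σ / (2 * E * E) * (‖S.D v p‖ * E)) := by
            gcongr
            exact min_le_left _ _
          _ = _ := by field_simp
      nlinarith
  · intro w b hb x hx
    by_cases hxb : x = b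
    · subst hxb
      have := norm_nonneg (S.D w x)
      nlinarith [mul_pos hE hE]
    have hpos : 0 < ‖x - b‖ := norm_pos_iff.2 (sub_ne_zero.2 hxb)
    have a1 := ((hdis w b hb).2 x hx).1
    have a2 := ((hdis w x hx).2 b hb).2.1
    rw [norm_sub_rev, norm_sub_rev b x] at a2
    have a3 : ‖S.D w b‖ * ‖x - b‖ ≤ E * E * ‖S.D w x‖ * ‖x - b‖ := by
      calc _ ≤ _ := a1
        _ ≤ E * (E * (‖S.D w x‖ * ‖x - b‖)) := by gcongr
        _ = _ := by ring
    refine (le_of_mul_le_mul_right a3 hpos).trans ?_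
    gcongr
    linarith
  · intro y hy T hT0 hT1
    by_contra hcon
    push Not at hcon
    have key : ∀ n : ℕ, ∃ u : List (Fin S.m), u.length = n ∧ ∃ b ∈ A, S.word u b = y ∧
        T < ‖S.D u b‖ := by
      intro n
      induction n with
      | zero => exact ⟨[], rfl, y, hy, rfl, by simpa [HolIFS.D] using hT1⟩
      | succ n ih =>
        obtain ⟨u, hu, b, hb, hub, hT⟩ := ih
        obtain ⟨i, b', hb', rfl⟩ := hA.pre hb
        have e0 : S.word (u ++ [i]) b' = y := by rw [S.word_append]; exact hub
        refine ⟨u ++ [i], by simp [hu], b', hb', e0, hcon _ _ hb' e0 ?_⟩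
        rw [S.D_append, norm_mul]
        have e1 : S.D [i] b' = deriv (S.g i) b' := by simp [HolIFS.D, HolIFS.word_nil]
        have e2 : S.word [i] b' = S.g i b' := rfl
        rw [e1, e2, mul_comm]
        have := h1 i b' hb'
        gcongr
    obtain ⟨n, hn⟩ := exists_pow_lt_of_lt_one (show 0 < T / E by positivity) hq1
    obtain ⟨u, hu, b, hb, -, hT⟩ := key n
    have := (hdis u b hb).1
    rw [hu] at this
    rw [lt_div_iff₀ hE] at hn
    linarith

set_option maxHeartbeats 2000000 in
lemma core {G F : HolIFS} {A : Set ℂ} (hG : G.IsAttractor A) (hF : F.IsAttractor A)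
    (hA2 : A.Nontrivial) (hSG : G.SSC A) (hSF : F.SSC A) {β y : ℂ} (hβ : β ∈ A) (κ : ℝ)
    (hκ : 0 < κ) :
    ∃ ε : ℝ, 0 < ε ∧ ∀ (W₁ W₂ : List (Fin G.m)) (u₁ u₂ : List (Fin F.m)), ∀ b₁ ∈ A, ∀ b₂ ∈ A,
      G.word W₁ β = y → G.word W₂ β = y → F.word u₁ b₁ = y → F.word u₂ b₂ = y →
      κ * ‖G.D W₁ β‖ ≤ ‖F.D u₁ b₁‖ → ‖F.D u₁ b₁‖ ≤ ‖G.D W₁ β‖ →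
      κ * ‖G.D W₂ β‖ ≤ ‖F.D u₂ b₂‖ → ‖F.D u₂ b₂‖ ≤ ‖G.D W₂ β‖ →
      ‖b₁ - b₂‖ < ε → ‖G.D W₁ β / F.D u₁ b₁ - G.D W₂ β / F.D u₂ b₂‖ < ε → b₁ = b₂ := by
  obtain ⟨cG, CG, κG, qG, hcG, hCG, hκG, hqG0, hqG1, hG1, hG2, hG3, hG4, hG5, hG6⟩ := hSG.pack hG hA2
  obtain ⟨cF, CF, κF, qF, hcF, hCF, hκF, hqF0, hqF1, hF1, hF2, hF3, hF4, hF5, hF6⟩ := hSF.pack hF hA2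
  obtain ⟨Δ, hΔ, hd⟩ := hG.bdd
  -- general facts about data
  have Hfwd : ∀ (W : List (Fin G.m)) (u : List (Fin F.m)), ∀ b ∈ A, G.word W β = y →
      F.word u b = y → κ * ‖G.D W β‖ ≤ ‖F.D u b‖ → ∀ z ∈ A, CG / κ * ‖z - β‖ ≤ cF →
      ∃ x ∈ A, F.word u x = G.word W z ∧ ‖x - b‖ ≤ CG / (κ * cF) * ‖z - β‖ := by
    intro W u b hb hW hu hle z hz hzs
    have hDpos : 0 < ‖F.D u b‖ := norm_pos_iff.2 (hF.D_ne u hb)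
    have e1 : ‖G.word W z - F.word u b‖ ≤ CG / κ * ‖z - β‖ * ‖F.D u b‖ := by
      have := hG3 W β hβ z hz
      rw [hu, ← hW]
      calc _ ≤ _ := this
        _ = CG / κ * ‖z - β‖ * (κ * ‖G.D W β‖) := by field_simp
        _ ≤ _ := by gcongr
    obtain ⟨x, hx, hxe, hxn⟩ := hF4 u b hb (G.word W z) (hG.word_mem W hz)
      (e1.trans (by gcongr))
    refine ⟨x, hx, hxe, ?_⟩
    have e2 : ‖x - b‖ * (cF * ‖F.D u b‖) ≤ (CG / (κ * cF) * ‖z - β‖) * (cF * ‖F.D u b‖) := by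
      calc _ = cF * ‖F.D u b‖ * ‖x - b‖ := by ring
        _ ≤ _ := hxn.trans e1
        _ = _ := by field_simp
    exact le_of_mul_le_mul_right e2 (by positivity)
  have Hback : ∀ (W : List (Fin G.m)) (u : List (Fin F.m)), ∀ b ∈ A, G.word W β = y →
      F.word u b = y → ‖F.D u b‖ ≤ ‖G.D W β‖ → ∀ x ∈ A, CF * ‖x - b‖ ≤ cG →
      ∃ z ∈ A, G.word W z = F.word u x ∧ ‖z - β‖ ≤ CF / cG * ‖x - b‖ := by
    intro W u b hb hW hu hle x hx hxs
    have hDpos : 0 < ‖G.D W β‖ := norm_pos_iff.2 (hG.D_ne W hβ)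
    have e1 : ‖F.word u x - G.word W β‖ ≤ CF * ‖x - b‖ * ‖G.D W β‖ := by
      have := hF3 u b hb x hx
      rw [hW, ← hu]
      calc _ ≤ _ := this
        _ = CF * ‖x - b‖ * ‖F.D u b‖ := by ring
        _ ≤ _ := by gcongr
    obtain ⟨z, hz, hze, hzn⟩ := hG4 W β hβ (F.word u x) (hF.word_mem u hx)
      (e1.trans (by gcongr))
    refine ⟨z, hz, hze, ?_⟩
    have e2 : ‖z - β‖ * (cG * ‖G.D W β‖) ≤ (CF / cG * ‖x - b‖) * (cG * ‖G.D W β‖) := by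
      calc _ = cG * ‖G.D W β‖ * ‖z - β‖ := by ring
        _ ≤ _ := hzn.trans e1
        _ = _ := by field_simp
    exact le_of_mul_le_mul_right e2 (by positivity)
  have Hquad : ∀ (W : List (Fin G.m)) (u : List (Fin F.m)), ∀ b ∈ A, G.word W β = y →
      F.word u b = y → κ * ‖G.D W β‖ ≤ ‖F.D u b‖ → ∀ z ∈ A, ∀ x ∈ A, F.word u x = G.word W z →
      ‖x - b - G.D W β / F.D u b * (z - β)‖ ≤ CG / κ * ‖z - β‖ ^ 2 + CF * ‖x - b‖ ^ 2 := by
    intro W u b hb hW hu hle z hz x hx hxz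
    have hDne := hF.D_ne u hb
    have hDpos : 0 < ‖F.D u b‖ := norm_pos_iff.2 hDne
    have a1 := hG2 W β hβ z hz
    have a2 := hF2 u b hb x hx
    have e1 : (x - b - G.D W β / F.D u b * (z - β)) * F.D u b =
        (G.word W z - G.word W β - G.D W β * (z - β)) -
        (F.word u x - F.word u b - F.D u b * (x - b)) := by
      rw [hxz, hW, hu]; field_simp; ring
    have e2 : ‖x - b - G.D W β / F.D u b * (z - β)‖ * ‖F.D u b‖ ≤
        (CG / κ * ‖z - β‖ ^ 2 + CF * ‖x - b‖ ^ 2) * ‖F.D u b‖ := by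
      rw [← norm_mul, e1]
      refine (norm_sub_le _ _).trans ((add_le_add a1 a2).trans ?_)
      calc CG * (‖G.D W β‖ * ‖z - β‖ ^ 2) + CF * (‖F.D u b‖ * ‖x - b‖ ^ 2)
          = CG / κ * ‖z - β‖ ^ 2 * (κ * ‖G.D W β‖) + CF * ‖x - b‖ ^ 2 * ‖F.D u b‖ := by
            field_simp
        _ ≤ CG / κ * ‖z - β‖ ^ 2 * ‖F.D u b‖ + CF * ‖x - b‖ ^ 2 * ‖F.D u b‖ := by gcongr
        _ = _ := by ring
    exact le_of_mul_le_mul_right e2 hDpos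
  -- constants
  set K := 2 * CF / (κF * cF) with hK
  have hK0 : 0 < K := by positivity
  set H' := CF * Δ * K with hH'
  have hH'0 : 0 < H' := by positivity
  set H := CF / cG * H' with hH
  have hH0 : 0 < H := by positivity
  set C1 := CG / (κ * cF) with hC1
  have hC10 : 0 < C1 := by positivity
  set Q := 2 * (CG / κ) * H ^ 2 + CF * ((C1 * H) ^ 2 + H' ^ 2) with hQ
  have hQ0 : 0 < Q := by positivity
  -- choice of ε
  obtain ⟨ε, hε0, hε1, hε2, hε3, hε4⟩ : ∃ ε : ℝ, 0 < ε ∧ K * ε < 1 ∧ CF * (H' * ε) ≤ cG ∧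
      CG / κ * (H * ε) ≤ cF ∧ ε * (H + Q) ≤ 1 / 2 := by
    refine ⟨1 / (2 * K + CF * H' / cG + CG / κ * H / cF + 2 * (H + Q)), by positivity, ?_, ?_, ?_, ?_⟩
    · rw [mul_one_div, div_lt_one (by positivity)]
      have : 0 < CF * H' / cG + CG / κ * H / cF + 2 * (H + Q) := by positivity
      linarith
    · rw [← mul_assoc, mul_one_div, div_le_iff₀ (by positivity)]
      have h1 : 0 ≤ cG * (2 * K + CG / κ * H / cF + 2 * (H + Q)) := by positivity
      have h2 : cG * (CF * H' / cG) = CF * H' := by field_simp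
      linarith
    · rw [← mul_assoc, mul_one_div, div_le_iff₀ (by positivity)]
      have h1 : 0 ≤ cF * (2 * K + CF * H' / cG + 2 * (H + Q)) := by positivity
      have h2 : cF * (CG / κ * H / cF) = CG / κ * H := by field_simp
      linarith
    · rw [mul_comm, mul_one_div, div_le_iff₀ (by positivity)]
      have : 0 < 2 * K + CF * H' / cG + CG / κ * H / cF := by positivity
      linarith
  refine ⟨ε, hε0, ?_⟩
  intro W₁ W₂ u₁ u₂ b₁ hb₁ b₂ hb₂ hW₁ hW₂ hu₁ hu₂ hl₁ hr₁ hl₂ hr₂ hbb haa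
  by_contra hne
  set e := ‖b₁ - b₂‖ with he
  have he0 : 0 < e := norm_pos_iff.2 (sub_ne_zero.2 hne)
  have hee : e ≤ ε := hbb.le
  obtain ⟨w, b', hb', hwb', hT1, hT2⟩ := hF6 b₁ hb₁ (K * e) (by positivity)
    (lt_of_le_of_lt (by gcongr) hε1)
  -- extremal point
  have hcont : ContinuousOn (fun p => (F.word w p * (starRingEnd ℂ) (b₂ - b₁)).re) A :=
    Complex.continuous_re.comp_continuousOn ((hF.word_cont w).mul continuousOn_const)
  obtain ⟨p, hp, hmax⟩ := hF.2.1.exists_isMaxOn hF.1 hcont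
  set x := F.word w p with hx
  have hxA : x ∈ A := hF.word_mem w hp
  have hxb : ‖x - b₁‖ ≤ H' * e := by
    have := hF3 w b' hb' p hp
    rw [hwb'] at this
    calc _ ≤ _ := this
      _ ≤ CF * (K * e * Δ) := by gcongr; exact hd p hp b' hb'
      _ = _ := by rw [hH']; ring
  obtain ⟨z, hz, hzx, hzn⟩ := Hback W₁ u₁ b₁ hb₁ hW₁ hu₁ hr₁ x hxA (by
    calc CF * ‖x - b₁‖ ≤ CF * (H' * ε) := by
          gcongr; exact hxb.trans (by gcongr)
      _ ≤ _ := hε2)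
  have hzn' : ‖z - β‖ ≤ H * e := by
    calc _ ≤ _ := hzn
      _ ≤ CF / cG * (H' * e) := by gcongr
      _ = _ := by rw [hH]; ring
  obtain ⟨x', hx'A, hx'z, hx'n⟩ := Hfwd W₂ u₂ b₂ hb₂ hW₂ hu₂ hl₂ z hz (by
    calc CG / κ * ‖z - β‖ ≤ CG / κ * (H * ε) := by
          gcongr; exact hzn'.trans (by gcongr)
      _ ≤ _ := hε3)
  have hx'n' : ‖x' - b₂‖ ≤ C1 * H * e := by
    calc _ ≤ _ := hx'n
      _ ≤ C1 * (H * e) := by gcongr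
      _ = _ := by ring
  have q1 := Hquad W₁ u₁ b₁ hb₁ hW₁ hu₁ hl₁ z hz x hxA hzx.symm
  have q2 := Hquad W₂ u₂ b₂ hb₂ hW₂ hu₂ hl₂ z hz x' hx'A hx'z
  set a₁ := G.D W₁ β / F.D u₁ b₁
  set a₂ := G.D W₂ β / F.D u₂ b₂
  have hmain : ‖x' - x - (b₂ - b₁)‖ ≤ e / 2 := by
    have e1 : x' - x - (b₂ - b₁) = (x' - b₂ - a₂ * (z - β)) - (x - b₁ - a₁ * (z - β))
        - (a₁ - a₂) * (z - β) := by ring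
    have e2 : ‖x' - x - (b₂ - b₁)‖ ≤ (CG / κ * ‖z - β‖ ^ 2 + CF * ‖x' - b₂‖ ^ 2) +
        (CG / κ * ‖z - β‖ ^ 2 + CF * ‖x - b₁‖ ^ 2) + ε * ‖z - β‖ := by
      rw [e1]
      refine (norm_sub_le _ _).trans (add_le_add ((norm_sub_le _ _).trans (add_le_add q2 q1)) ?_)
      rw [norm_mul]
      gcongr
    calc _ ≤ _ := e2
      _ ≤ (CG / κ * (H * e) ^ 2 + CF * (C1 * H * e) ^ 2) +
        (CG / κ * (H * e) ^ 2 + CF * (H' * e) ^ 2) + ε * (H * e) := by gcongr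
      _ = e * (e * Q + ε * H) := by rw [hQ]; ring
      _ ≤ e * (ε * Q + ε * H) := by gcongr
      _ ≤ e * (1 / 2) := by gcongr; linarith
      _ = e / 2 := by ring
  have hebb : ‖b₂ - b₁‖ = e := by rw [he, norm_sub_rev]
  have hclose : ‖x' - F.word w p‖ ≤ cF * ‖F.D w p‖ := by
    have e1 : ‖x' - x‖ ≤ 2 * e := by
      have : x' - x = (x' - x - (b₂ - b₁)) + (b₂ - b₁) := by ring
      rw [this]
      refine (norm_add_le _ _).trans ?_
      linarith
    have e2 := hF5 w b' hb' p hp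
    have e3 : 2 * e * CF ≤ cF * ‖F.D w p‖ * CF := by
      calc 2 * e * CF = cF * (κF * (K * e)) := by rw [hK]; field_simp
        _ ≤ cF * (CF * ‖F.D w p‖) := mul_le_mul_of_nonneg_left (hT1.trans e2) hcF.le
        _ = _ := by ring
    exact e1.trans (le_of_mul_le_mul_right e3 hCF)
  obtain ⟨p', hp', hp'x, -⟩ := hF4 w p hp x' hx'A hclose
  have hle : (F.word w p' * (starRingEnd ℂ) (b₂ - b₁)).re ≤
      (F.word w p * (starRingEnd ℂ) (b₂ - b₁)).re := hmax hp'
  rw [hp'x, ← hx] at hle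
  have f1 : (x' * (starRingEnd ℂ) (b₂ - b₁)).re - (x * (starRingEnd ℂ) (b₂ - b₁)).re =
      ((x' - x - (b₂ - b₁)) * (starRingEnd ℂ) (b₂ - b₁)).re + e ^ 2 := by
    have g1 : ((b₂ - b₁) * (starRingEnd ℂ) (b₂ - b₁)).re = e ^ 2 := by
      rw [Complex.mul_conj, Complex.ofReal_re, Complex.normSq_eq_norm_sq, hebb]
    rw [← g1, ← Complex.sub_re, ← Complex.add_re]
    congr 1; ring
  have f2 : |((x' - x - (b₂ - b₁)) * (starRingEnd ℂ) (b₂ - b₁)).re| ≤ e / 2 * e := by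
    refine (Complex.abs_re_le_norm _).trans ?_
    rw [norm_mul, RCLike.norm_conj, hebb]
    gcongr
  have f3 := neg_abs_le (((x' - x - (b₂ - b₁)) * (starRingEnd ℂ) (b₂ - b₁)).re)
  nlinarith

open Filter Topology in
lemma prep_subset_of_same {G F : HolIFS} {A : Set ℂ} (hG : G.IsAttractor A) (hF : F.IsAttractor A)
    (hA2 : A.Nontrivial) (hSG : G.SSC A) (hSF : F.SSC A) : G.Prep ⊆ F.Prep := by
  rintro y ⟨v, β, hβP, rfl⟩
  have hβ : β ∈ A := hG.per_subset hβP
  obtain ⟨hβΩ, w, hw, hfix⟩ := hβP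
  set y := G.word v β with hy
  have hyA : y ∈ A := hG.word_mem v hβ
  obtain ⟨cG, CG, κG, qG, hcG, hCG, hκG, hqG0, hqG1, hG1, -⟩ := hSG.pack hG hA2
  obtain ⟨cF, CF, κ, qF, hcF, hCF, hκ, hqF0, hqF1, hF1, hF2, hF3, hF4, hF5, hF6⟩ := hSF.pack hF hA2
  obtain ⟨ε, hε, hcore⟩ := core (y := y) hG hF hA2 hSG hSF hβ κ hκ
  have hdata : ∀ k : ℕ, ∃ (W : List (Fin G.m)) (u : List (Fin F.m)) (b : ℂ), b ∈ A ∧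
      G.word W β = y ∧ F.word u b = y ∧ κ * ‖G.D W β‖ ≤ ‖F.D u b‖ ∧ ‖F.D u b‖ ≤ ‖G.D W β‖ ∧
      ‖G.D W β‖ < 1 / ((k : ℝ) + 1) := by
    intro k
    have hk0 : (0 : ℝ) < 1 / ((k : ℝ) + 1) := by positivity
    obtain ⟨n, hn⟩ := exists_pow_lt_of_lt_one (show 0 < 1 / ((k : ℝ) + 1) / CG by positivity) hqG1
    obtain ⟨u', hu'1, hu'2⟩ := G.iter_word hw n
    have hWβ : G.word (v ++ u') β = y := by
      rw [G.word_append, hu'2, Function.IsFixedPt.iterate hfix n]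
    have hlt : ‖G.D (v ++ u') β‖ < 1 / ((k : ℝ) + 1) := by
      refine (hG1 (v ++ u') β hβ).trans_lt ?_
      have h5 : qG ^ (v ++ u').length ≤ qG ^ n :=
        pow_le_pow_of_le_one hqG0.le hqG1.le (by simp; omega)
      rw [lt_div_iff₀ hCG] at hn
      nlinarith
    have hpos : 0 < ‖G.D (v ++ u') β‖ := norm_pos_iff.2 (hG.D_ne _ hβ)
    have hlt1 : ‖G.D (v ++ u') β‖ < 1 := by
      refine hlt.trans_le ?_
      rw [div_le_one (by positivity)]
      have : (0 : ℝ) ≤ k := Nat.cast_nonneg k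
      linarith
    obtain ⟨u, b, hb, hub, h1, h2⟩ := hF6 y hyA _ hpos hlt1
    exact ⟨v ++ u', u, b, hb, hWβ, hub, h1, h2, hlt⟩
  choose W u b hb hW hu h1 h2 h3 using hdata
  have hK : IsCompact (A ×ˢ closedBall (0 : ℂ) (1 / κ)) := hG.2.1.prod (isCompact_closedBall _ _)
  have hmem : ∀ k, ((b k, G.D (W k) β / F.D (u k) (b k)) : ℂ × ℂ) ∈ A ×ˢ closedBall (0 : ℂ) (1 / κ) := by
    intro k
    refine ⟨hb k, ?_⟩
    have hDpos : 0 < ‖F.D (u k) (b k)‖ := norm_pos_iff.2 (hF.D_ne _ (hb k))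
    rw [mem_closedBall, dist_zero_right, norm_div, div_le_div_iff₀ hDpos hκ]
    have := h1 k
    linarith
  obtain ⟨pt, -, φ, hφ, hlim⟩ := hK.tendsto_subseq hmem
  have hc := hlim.cauchySeq
  rw [Metric.cauchySeq_iff] at hc
  obtain ⟨N, hN⟩ := hc ε hε
  have hDN : 0 < ‖F.D (u (φ N)) (b (φ N))‖ := norm_pos_iff.2 (hF.D_ne _ (hb _))
  obtain ⟨M, hM⟩ := exists_nat_one_div_lt hDN
  set j := max N M with hj
  have hdist := hN N le_rfl j (le_max_left _ _)
  have hlt : ‖F.D (u (φ j)) (b (φ j))‖ < ‖F.D (u (φ N)) (b (φ N))‖ := by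
    refine (h2 (φ j)).trans_lt ((h3 (φ j)).trans_le (le_trans ?_ hM.le))
    have : M ≤ φ j := (le_max_right N M).trans (hφ.id_le j)
    gcongr
  rw [Prod.dist_eq, max_lt_iff] at hdist
  simp only [Function.comp, dist_eq_norm] at hdist
  have hbeq : b (φ N) = b (φ j) := hcore (W (φ N)) (W (φ j)) (u (φ N)) (u (φ j)) _ (hb _) _ (hb _)
    (hW _) (hW _) (hu _) (hu _) (h1 _) (h2 _) (h1 _) (h2 _) hdist.1 hdist.2
  have hune : u (φ N) ≠ u (φ j) := by
    intro h
    rw [h, hbeq] at hlt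
    exact lt_irrefl _ hlt
  have hconc : ∀ (s t : List (Fin F.m)) (c : ℂ), c ∈ A → F.word s c = y → F.word t c = y →
      s ≠ t → s.length ≤ t.length → y ∈ F.Prep := by
    intro s t c hc hs ht hst hle
    obtain ⟨r, hr, hrc⟩ := hSF.word_ext hF s t hc hc hle (hs.trans ht.symm)
    refine ⟨s, c, ⟨hF.2.2.1 hc, r, ?_, hrc⟩, hs.symm⟩
    rintro rfl
    simp at hr
    exact hst hr.symm
  have hu' := hu (φ N)
  rw [hbeq] at hu'
  rcases le_total (u (φ N)).length (u (φ j)).length with h | h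
  · exact hconc _ _ _ (hb (φ j)) hu' (hu _) hune h
  · exact hconc _ _ _ (hb (φ j)) (hu _) hu' hune.symm h

/-- Corollary: two holomorphic IFS with the SSC have the same attractor iff
`Prep_G = Prep_F`. -/
theorem stmt_14 (G F : HolIFS) (Ag Af : Set ℂ)
    (hAg : G.IsAttractor Ag) (hAg2 : Ag.Nontrivial) (hSSCg : G.SSC Ag)
    (hAf : F.IsAttractor Af) (hAf2 : Af.Nontrivial) (hSSCf : F.SSC Af) :
    Ag = Af ↔ G.Prep = F.Prep := by
  constructor
  · rintro rfl
    exact Subset.antisymm (prep_subset_of_same hAg hAf hAg2 hSSCg hSSCf)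
      (prep_subset_of_same hAf hAg hAg2 hSSCf hSSCg)
  · intro h
    rw [← hAg.closure_prep, ← hAf.closure_prep, h]
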